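/- arXiv:1502.01980 — 5 statements merged into one kernel-verified Lean document; each statement's English description precedes it below -/
import Mathlib

section
/- Fix W > 0, S > 0, N > 0 and β ∈ (0, 1). The SISO AQNM achievable rate R(P) = W · log₂(1 + (1 − β) S P / (β S P + N)) is a concave function of the transmit power P on [0, ∞). -/
/-- The saturating map `x ↦ c x / (d x + n)` is concave on `[0, ∞)`. -/
theorem concaveOn_mul_div_mul_add {c d n : ℝ} (hc : 0 ≤ c) (hd : 0 ≤ d) (hn : 0 < n) :
    ConcaveOn ℝ (Set.Ici 0) (fun x : ℝ => c * x / (d * x + n)) := by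
  refine ⟨convex_Ici 0, fun x hx y hy a b ha hb hab => ?_⟩
  rw [Set.mem_Ici] at hx hy
  simp only [smul_eq_mul]
  have hu : 0 < d * x + n := by positivity
  have hv : 0 < d * y + n := by positivity
  have hw : 0 < d * (a * x + b * y) + n := by positivity
  obtain rfl : b = 1 - a := by linarith
  have key : c * (a * x + (1 - a) * y) / (d * (a * x + (1 - a) * y) + n)
      - (a * (c * x / (d * x + n)) + (1 - a) * (c * y / (d * y + n)))
      = c * n * d * (a * (1 - a)) * (x - y) ^ 2
        / ((d * x + n) * (d * y + n) * (d * (a * x + (1 - a) * y) + n)) := by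
    rw [eq_div_iff (by positivity)]
    field_simp
    ring
  rw [← sub_nonneg, key]
  positivity

/-- The logarithm of a positive concave function is concave. -/
theorem ConcaveOn.log_of_pos {s : Set ℝ} {f : ℝ → ℝ} (hf : ConcaveOn ℝ s f)
    (hpos : ∀ x ∈ s, 0 < f x) : ConcaveOn ℝ s (fun x => Real.log (f x)) := by
  refine ⟨hf.1, fun x hx y hy a b ha hb hab => ?_⟩
  have hlog := strictConcaveOn_log_Ioi.concaveOn
  refine (hlog.2 (hpos x hx) (hpos y hy) ha hb hab).trans ?_
  exact Real.log_le_log (hlog.1 (hpos x hx) (hpos y hy) ha hb hab) (hf.2 hx hy ha hb hab)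

/-- The SISO AQNM achievable rate
`R(P) = W · log₂(1 + (1 − β) S P / (β S P + N))`
is a concave function of the transmit power `P` on `[0, ∞)`. -/
theorem siso_aqnm_rate_concaveOn_power
    (W S N β : ℝ) (hW : 0 < W) (hS : 0 < S) (hN : 0 < N)
    (hβ0 : 0 < β) (hβ1 : β < 1) :
    ConcaveOn ℝ (Set.Ici 0)
      (fun P : ℝ => W * Real.logb 2 (1 + (1 - β) * S * P / (β * S * P + N))) := by
  have hβ : 0 < 1 - β := sub_pos.mpr hβ1
  have hsnr : ConcaveOn ℝ (Set.Ici 0)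
      (fun P : ℝ => 1 + (1 - β) * S * P / (β * S * P + N)) :=
    (concaveOn_const 1 (convex_Ici 0)).add
      (concaveOn_mul_div_mul_add (by positivity) (by positivity) hN)
  have hlog := hsnr.log_of_pos fun P hP => by
    rw [Set.mem_Ici] at hP
    positivity
  have hlog2 : 0 < Real.log 2 := Real.log_pos one_lt_two
  refine (hlog.smul (c := W / Real.log 2) (by positivity)).congr fun P _ => ?_
  simp only [smul_eq_mul, Real.logb]
  ring
end

section
/- Let S > 0, N₀ > 0, a > 0, c > 0, K > 0, and suppose (W, b) with W > 0 and b > 0 satisfies the power constraint 2·c·W·b < K (strict inequality, i.e., slack). Then the point (W, b') with b' = K/(2·c·W) is feasible for the same constraint (with equality) and achieves a strictly larger value of the objective W · log₂(1 + (1 − a·b⁻²)·S / (a·b⁻²·S + W·N₀)). Consequently, at any maximizer of the objective over {(W, b) : 0 < W, 0 < b, 2·c·W·b ≤ K}, the power constraint holds with equality: 2·c·W·b = K. -/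
/-- SISO AQNM achievable rate as a function of bandwidth `W` and number of
quantization bins `b`, with received signal power `S`, noise spectral density
`N₀`, and quantizer constant `a` (distortion `β = a·b⁻²`). -/
noncomputable def sisoRate (S N₀ a W b : ℝ) : ℝ :=
  W * Real.logb 2 (1 + (1 - a / b ^ 2) * S / ((a / b ^ 2) * S + W * N₀))

/-- The argument of the logarithm in `sisoRate` is a quotient of positive quantities in which the
distortion occurs only in the denominator. -/
theorem sisoRate_eq {S N₀ a W : ℝ} (hS : 0 < S) (hN₀ : 0 < N₀) (ha : 0 < a) (hW : 0 < W) (b : ℝ) :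
    sisoRate S N₀ a W b = W * Real.logb 2 ((S + W * N₀) / (a / b ^ 2 * S + W * N₀)) := by
  have h : 0 < a / b ^ 2 * S + W * N₀ := by positivity
  rw [sisoRate, one_add_div h.ne']
  ring_nf

/-- At fixed bandwidth the rate is strictly increasing in the number of quantization bins. -/
theorem sisoRate_strictMonoOn {S N₀ a W : ℝ} (hS : 0 < S) (hN₀ : 0 < N₀) (ha : 0 < a)
    (hW : 0 < W) : StrictMonoOn (sisoRate S N₀ a W) (Set.Ioi 0) := by
  intro b hb b' hb' hlt
  have hb : 0 < b := hb
  have hb' : 0 < b' := hb'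
  rw [sisoRate_eq hS hN₀ ha hW, sisoRate_eq hS hN₀ ha hW]
  refine mul_lt_mul_of_pos_left (Real.logb_lt_logb one_lt_two (by positivity) ?_) hW
  gcongr

/-- If `(W, b)` satisfies the ADC power constraint `2cWb < K` with slack then
`(W, K/(2cW))` is feasible with equality and achieves a strictly larger rate;
consequently at any maximizer of the rate over the feasible set the power
constraint is tight: `2cWb = K`. -/
theorem siso_power_constraint_tight_at_optimum
    (S N₀ a c K W b : ℝ)
    (hS : 0 < S) (hN₀ : 0 < N₀) (ha : 0 < a) (hc : 0 < c) (hK : 0 < K)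
    (hW : 0 < W) (hb : 0 < b) (hslack : 2 * c * W * b < K) :
    (2 * c * W * (K / (2 * c * W)) = K ∧
      sisoRate S N₀ a W b < sisoRate S N₀ a W (K / (2 * c * W))) ∧
    (∀ W₀ b₀ : ℝ, 0 < W₀ → 0 < b₀ → 2 * c * W₀ * b₀ ≤ K →
      (∀ W' b' : ℝ, 0 < W' → 0 < b' → 2 * c * W' * b' ≤ K →
        sisoRate S N₀ a W' b' ≤ sisoRate S N₀ a W₀ b₀) →
      2 * c * W₀ * b₀ = K) := by
  have improve : ∀ w x : ℝ, 0 < w → 0 < x → 2 * c * w * x < K →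
      sisoRate S N₀ a w x < sisoRate S N₀ a w (K / (2 * c * w)) := by
    intro w x hw hx h
    refine sisoRate_strictMonoOn hS hN₀ ha hw hx (Set.mem_Ioi.2 (by positivity)) ?_
    rw [lt_div_iff₀ (by positivity)]
    linarith
  refine ⟨⟨mul_div_cancel₀ K (by positivity), improve W b hW hb hslack⟩, ?_⟩
  intro W₀ b₀ hW₀ hb₀ hle hmax
  by_contra hne
  refine (improve W₀ b₀ hW₀ hb₀ (lt_of_le_of_ne hle hne)).not_ge
    (hmax W₀ _ hW₀ (by positivity) (le_of_eq ?_))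
  field_simp
end

section
/- Let A > 0, N₀ > 0 and d > 0, and define f(W) = W · log₂((A + W·N₀) / (d·W²·A + W·N₀)) for W > 0. Then f(W) → −∞ as W → ∞. -/
open Filter

/-- The reduced SISO objective
`f(W) = W · log₂((A + W·N₀)/(d·W²·A + W·N₀))` tends to `−∞` as `W → ∞`. -/
theorem reduced_siso_objective_tendsto_atBot
    (A N₀ d : ℝ) (hA : 0 < A) (hN₀ : 0 < N₀) (hd : 0 < d) :
    Tendsto
      (fun W : ℝ =>
        W * Real.logb 2 ((A + W * N₀) / (d * W ^ 2 * A + W * N₀)))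
      atTop atBot := by
  -- For large `W` the ratio is at most `1/2`, so the objective is at most `-W`.
  refine tendsto_atBot_mono' atTop ?_ tendsto_neg_atTop_atBot
  filter_upwards [eventually_ge_atTop (1 : ℝ),
    eventually_ge_atTop ((2 * A + N₀) / (d * A))] with W hW hWlarge
  have hW0 : 0 < W := by linarith
  have hlin : 2 * A + N₀ ≤ W * (d * A) := (div_le_iff₀ (by positivity)).1 hWlarge
  have hratio : (A + W * N₀) / (d * W ^ 2 * A + W * N₀) ≤ (2 : ℝ) ^ (-1 : ℝ) := by
    rw [Real.rpow_neg_one, div_le_iff₀ (by positivity)]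
    nlinarith [mul_le_mul_of_nonneg_right hlin hW0.le, mul_le_mul_of_nonneg_left hW hA.le]
  have hlog : Real.logb 2 ((A + W * N₀) / (d * W ^ 2 * A + W * N₀)) ≤ -1 :=
    (Real.logb_le_iff_le_rpow one_lt_two (by positivity)).2 hratio
  nlinarith
end

section
/- Let A > 0, N₀ > 0 and d > 0. The function f(W) = W · log₂((A + W·N₀) / (d·W²·A + W·N₀)) is concave on (0, ∞). -/
/-- The function `W ↦ W · log (a + b W)` has derivative `log (a + b W) + b W / (a + b W)`. -/
lemma hasDerivAt_mul_log_affine (a b W : ℝ) (h : a + b * W ≠ 0) :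
    HasDerivAt (fun x : ℝ => x * Real.log (a + b * x))
      (Real.log (a + b * W) + b * W / (a + b * W)) W := by
  have haff : HasDerivAt (fun x : ℝ => a + b * x) b W := by
    simpa using ((hasDerivAt_id W).const_mul b).const_add a
  refine ((hasDerivAt_id' W).mul (haff.log h)).congr_deriv ?_
  ring

/-- The second derivative of `W ↦ W · log (a + b W)`. -/
lemma hasDerivAt_deriv_mul_log_affine (a b W : ℝ) (h : a + b * W ≠ 0) :
    HasDerivAt (fun x : ℝ => Real.log (a + b * x) + b * x / (a + b * x))
      (b / (a + b * W) + a * b / (a + b * W) ^ 2) W := by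
  have hlin : HasDerivAt (fun x : ℝ => b * x) b W := by
    simpa using (hasDerivAt_id W).const_mul b
  have haff : HasDerivAt (fun x : ℝ => a + b * x) b W := hlin.const_add a
  refine ((haff.log h).add (hlin.div haff h)).congr_deriv ?_
  ring

/-- `W ↦ W · log (a + b W)` is convex on the positive half-line when `0 < a` and
`0 ≤ b`. -/
lemma convexOn_mul_log_affine {a b : ℝ} (ha : 0 < a) (hb : 0 ≤ b) :
    ConvexOn ℝ (Set.Ioi 0) (fun x : ℝ => x * Real.log (a + b * x)) := by
  have hpos : ∀ x ∈ Set.Ioi (0 : ℝ), 0 < a + b * x := fun x hx => by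
    have hx : 0 < x := hx
    positivity
  refine convexOn_of_hasDerivWithinAt2_nonneg (convex_Ioi 0)
    (fun x hx => (hasDerivAt_mul_log_affine a b x (hpos x hx).ne').continuousAt.continuousWithinAt)
    (f' := fun x => Real.log (a + b * x) + b * x / (a + b * x))
    (f'' := fun x => b / (a + b * x) + a * b / (a + b * x) ^ 2) ?_ ?_ ?_ <;>
    rw [interior_Ioi] <;> intro x hx
  · exact (hasDerivAt_mul_log_affine a b x (hpos x hx).ne').hasDerivWithinAt
  · exact (hasDerivAt_deriv_mul_log_affine a b x (hpos x hx).ne').hasDerivWithinAt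
  · have := hpos x hx
    positivity

/-- The perspective-type function `W ↦ W · log (a + b W) - W · log W` is concave on the positive
half-line. -/
lemma concaveOn_mul_log_affine_sub_mul_log {a b : ℝ} (ha : 0 < a) (hb : 0 ≤ b) :
    ConcaveOn ℝ (Set.Ioi 0) (fun x : ℝ => x * Real.log (a + b * x) - x * Real.log x) := by
  have hpos : ∀ x ∈ Set.Ioi (0 : ℝ), 0 < a + b * x := fun x hx => by
    have hx : 0 < x := hx
    positivity
  have hderiv : ∀ x ∈ Set.Ioi (0 : ℝ),
      HasDerivAt (fun x : ℝ => x * Real.log (a + b * x) - x * Real.log x)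
        (Real.log (a + b * x) + b * x / (a + b * x) - (Real.log x + 1)) x := fun x hx =>
    (hasDerivAt_mul_log_affine a b x (hpos x hx).ne').sub (Real.hasDerivAt_mul_log (ne_of_gt hx))
  refine concaveOn_of_hasDerivWithinAt2_nonpos (convex_Ioi 0)
    (fun x hx => (hderiv x hx).continuousAt.continuousWithinAt)
    (f' := fun x => Real.log (a + b * x) + b * x / (a + b * x) - (Real.log x + 1))
    (f'' := fun x => b / (a + b * x) + a * b / (a + b * x) ^ 2 - x⁻¹) ?_ ?_ ?_ <;>
    rw [interior_Ioi] <;> intro x hx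
  · exact (hderiv x hx).hasDerivWithinAt
  · exact ((hasDerivAt_deriv_mul_log_affine a b x (hpos x hx).ne').sub
      ((Real.hasDerivAt_log (ne_of_gt hx)).add_const 1)).hasDerivWithinAt
  · have hx : 0 < x := hx
    have hp := hpos x hx
    have heq : b / (a + b * x) + a * b / (a + b * x) ^ 2 - x⁻¹
        = -(a ^ 2 / (x * (a + b * x) ^ 2)) := by
      field_simp
      ring
    change b / (a + b * x) + a * b / (a + b * x) ^ 2 - x⁻¹ ≤ 0
    rw [heq, neg_nonpos]
    positivity

/-- The reduced SISO objective
`f(W) = W · log₂((A + W·N₀)/(d·W²·A + W·N₀))` is concave on `(0, ∞)`. -/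
theorem reduced_siso_objective_concaveOn
    (A N₀ d : ℝ) (hA : 0 < A) (hN₀ : 0 < N₀) (hd : 0 < d) :
    ConcaveOn ℝ (Set.Ioi 0)
      (fun W : ℝ =>
        W * Real.logb 2 ((A + W * N₀) / (d * W ^ 2 * A + W * N₀))) := by
  have hconc := ((concaveOn_mul_log_affine_sub_mul_log hA hN₀.le).sub
    (convexOn_mul_log_affine hN₀ (mul_pos hd hA).le)).smul
      (inv_nonneg.2 (Real.log_nonneg one_le_two))
  refine hconc.congr fun W hW => ?_
  have hW : 0 < W := hW
  have hfac : d * W ^ 2 * A + W * N₀ = W * (N₀ + d * A * W) := by ring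
  have hnum : A + W * N₀ ≠ 0 := by positivity
  have hden : N₀ + d * A * W ≠ 0 := by positivity
  simp only [Pi.sub_apply, smul_eq_mul]
  rw [hfac, Real.logb, Real.log_div hnum (mul_ne_zero hW.ne' hden), Real.log_mul hW.ne' hden,
    mul_comm N₀ W]
  ring
end

section
/- (Lemma 1) Let A > 0, N₀ > 0 and d > 0, and define f(W) = W · log₂((A + W·N₀) / (d·W²·A + W·N₀)) for W > 0. Then there exists a finite optimal bandwidth W* ∈ (0, ∞) such that f(W*) ≥ f(W) for all W > 0 and f(W*) > 0; moreover f is non-increasing on [W*, ∞), i.e., beyond W* the achievable rate decreases. -/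
/-- The rate in nats, expanded so that it is continuous up to zero bandwidth. -/
noncomputable def natRate (A N₀ d W : ℝ) : ℝ :=
  W * Real.log (A + W * N₀) - W * Real.log W - W * Real.log (d * W * A + N₀)

section natRate

variable {A N₀ d W : ℝ}

lemma mul_logb_eq_natRate_div (hA : 0 < A) (hN₀ : 0 < N₀) (hd : 0 < d) (hW : 0 < W) :
    W * Real.logb 2 ((A + W * N₀) / (d * W ^ 2 * A + W * N₀)) =
      natRate A N₀ d W / Real.log 2 := by
  have hfactor : d * W ^ 2 * A + W * N₀ = W * (d * W * A + N₀) := by ring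
  rw [Real.logb, hfactor, Real.log_div (by positivity) (by positivity),
    Real.log_mul (by positivity) (by positivity), natRate]
  ring

lemma continuousOn_natRate (hA : 0 < A) (hN₀ : 0 < N₀) (hd : 0 < d) :
    ContinuousOn (natRate A N₀ d) (Set.Ici 0) := by
  unfold natRate
  refine ContinuousOn.sub (ContinuousOn.sub ?_ Real.continuous_mul_log.continuousOn) ?_
  all_goals
    refine continuousOn_id.mul (ContinuousOn.log (by fun_prop) fun x hx => ?_)
    have hx0 : 0 ≤ x := hx
    positivity

lemma hasDerivAt_natRate (hA : 0 < A) (hN₀ : 0 < N₀) (hd : 0 < d) (hW : 0 < W) :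
    HasDerivAt (natRate A N₀ d)
      (Real.log (A + W * N₀) - Real.log W - Real.log (d * W * A + N₀)
        - A / (A + W * N₀) - d * A * W / (d * W * A + N₀)) W := by
  have hsignal : HasDerivAt (fun x => A + x * N₀) N₀ W := by
    simpa using ((hasDerivAt_id W).mul_const N₀).const_add A
  have hnoise : HasDerivAt (fun x => d * x * A + N₀) (d * A) W := by
    simpa using (((hasDerivAt_id W).const_mul d).mul_const A).add_const N₀
  have hid : HasDerivAt (fun x : ℝ => x) 1 W := hasDerivAt_id W
  have hderiv := ((hid.mul (hsignal.log (by positivity))).sub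
    (hid.mul (Real.hasDerivAt_log hW.ne'))).sub (hid.mul (hnoise.log (by positivity)))
  refine hderiv.congr_deriv ?_
  field_simp
  ring

lemma hasDerivAt_deriv_natRate (hA : 0 < A) (hN₀ : 0 < N₀) (hd : 0 < d) (hW : 0 < W) :
    HasDerivAt (fun x => Real.log (A + x * N₀) - Real.log x - Real.log (d * x * A + N₀)
        - A / (A + x * N₀) - d * A * x / (d * x * A + N₀))
      (-(A ^ 2 / (W * (A + W * N₀) ^ 2) + d * A / (d * W * A + N₀)
        + d * A * N₀ / (d * W * A + N₀) ^ 2)) W := by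
  have hsignal : HasDerivAt (fun x => A + x * N₀) N₀ W := by
    simpa using ((hasDerivAt_id W).mul_const N₀).const_add A
  have hnoise : HasDerivAt (fun x => d * x * A + N₀) (d * A) W := by
    simpa using (((hasDerivAt_id W).const_mul d).mul_const A).add_const N₀
  have hlin : HasDerivAt (fun x => d * A * x) (d * A) W := by
    simpa using (hasDerivAt_id W).const_mul (d * A)
  have hS : A + W * N₀ ≠ 0 := by positivity
  have hT : d * W * A + N₀ ≠ 0 := by positivity
  have hderiv := ((((hsignal.log hS).sub (Real.hasDerivAt_log hW.ne')).sub
    (hnoise.log hT)).sub ((hasDerivAt_const W A).div hsignal hS)).sub (hlin.div hnoise hT)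
  refine hderiv.congr_deriv ?_
  field_simp
  ring

lemma concaveOn_natRate (hA : 0 < A) (hN₀ : 0 < N₀) (hd : 0 < d) :
    ConcaveOn ℝ (Set.Ici 0) (natRate A N₀ d) := by
  refine concaveOn_of_hasDerivWithinAt2_nonpos (convex_Ici 0)
    (continuousOn_natRate hA hN₀ hd)
    (fun x hx => (hasDerivAt_natRate hA hN₀ hd ?_).hasDerivWithinAt)
    (fun x hx => (hasDerivAt_deriv_natRate hA hN₀ hd ?_).hasDerivWithinAt)
    (fun x hx => ?_)
  all_goals have hx0 : 0 < x := by simpa using hx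
  · exact hx0
  · exact hx0
  · rw [neg_nonpos]
    positivity

lemma natRate_pos (hA : 0 < A) (hN₀ : 0 < N₀) (hd : 0 < d) (hW : 0 < W)
    (hdW : d * W ^ 2 < 1) : 0 < natRate A N₀ d W := by
  have hlog : Real.log (W * (d * W * A + N₀)) < Real.log (A + W * N₀) :=
    Real.log_lt_log (by positivity) (by nlinarith)
  rw [Real.log_mul (by positivity) (by positivity)] at hlog
  unfold natRate
  nlinarith

lemma natRate_nonpos (hA : 0 < A) (hN₀ : 0 < N₀) (hd : 0 < d) (hW : 0 < W)
    (hdW : 1 ≤ d * W ^ 2) : natRate A N₀ d W ≤ 0 := by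
  have hlog : Real.log (A + W * N₀) ≤ Real.log (W * (d * W * A + N₀)) :=
    Real.log_le_log (by positivity) (by nlinarith)
  rw [Real.log_mul (by positivity) (by positivity)] at hlog
  unfold natRate
  nlinarith

lemma exists_isMaxOn_natRate (hA : 0 < A) (hN₀ : 0 < N₀) (hd : 0 < d) :
    ∃ M, 0 < M ∧ 0 < natRate A N₀ d M ∧ IsMaxOn (natRate A N₀ d) (Set.Ici 0) M := by
  obtain ⟨s, hs, hsd⟩ : ∃ s : ℝ, 0 < s ∧ d * s ^ 2 = 1 :=
    ⟨(√d)⁻¹, by positivity, by rw [inv_pow, Real.sq_sqrt hd.le, mul_inv_cancel₀ hd.ne']⟩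
  obtain ⟨M, hM, hmax⟩ := isCompact_Icc.exists_isMaxOn (Set.nonempty_Icc.2 hs.le)
    ((continuousOn_natRate hA hN₀ hd).mono Set.Icc_subset_Ici_self)
  have hpos : 0 < natRate A N₀ d M :=
    (natRate_pos hA hN₀ hd (half_pos hs) (by nlinarith)).trans_le
      (hmax ⟨(half_pos hs).le, (half_lt_self hs).le⟩)
  have hM0 : M ≠ 0 := by
    rintro rfl
    simp [natRate] at hpos
  refine ⟨M, hM.1.lt_of_ne' hM0, hpos, fun W hW => ?_⟩
  rcases le_or_gt W s with hWs | hWs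
  · exact hmax ⟨hW, hWs⟩
  · refine (natRate_nonpos hA hN₀ hd (hs.trans hWs) ?_).trans hpos.le
    rw [← hsd]
    gcongr

end natRate

/-- A concave function is antitone to the right of a maximizer. -/
lemma ConcaveOn.antitoneOn_of_isMaxOn {s : Set ℝ} {f : ℝ → ℝ} {M : ℝ}
    (hf : ConcaveOn ℝ s f) (hM : M ∈ s) (hmax : IsMaxOn f s M) :
    AntitoneOn f (s ∩ Set.Ici M) := by
  rintro x ⟨hxs, hMx⟩ y ⟨hys, -⟩ hxy
  rcases (Set.mem_Ici.1 hMx).eq_or_lt with rfl | hlt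
  · exact hmax hys
  · exact hf.right_le_of_le_left'' hM hys hlt hxy (hmax hxs)

/-- (Lemma 1) For the reduced SISO objective
`f(W) = W · log₂((A + W·N₀)/(d·W²·A + W·N₀))` there exists a finite optimal
bandwidth `W* ∈ (0, ∞)` maximizing `f` over `(0, ∞)`, with `f(W*) > 0`, and
`f` is non-increasing on `[W*, ∞)`: beyond `W*` the achievable rate decreases. -/
theorem exists_optimal_bandwidth
    (A N₀ d : ℝ) (hA : 0 < A) (hN₀ : 0 < N₀) (hd : 0 < d) :
    ∃ Wstar : ℝ, 0 < Wstar ∧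
      (∀ W : ℝ, 0 < W →
        W * Real.logb 2 ((A + W * N₀) / (d * W ^ 2 * A + W * N₀)) ≤
          Wstar * Real.logb 2
            ((A + Wstar * N₀) / (d * Wstar ^ 2 * A + Wstar * N₀))) ∧
      0 < Wstar * Real.logb 2
            ((A + Wstar * N₀) / (d * Wstar ^ 2 * A + Wstar * N₀)) ∧
      AntitoneOn
        (fun W : ℝ =>
          W * Real.logb 2 ((A + W * N₀) / (d * W ^ 2 * A + W * N₀)))
        (Set.Ici Wstar) := by
  obtain ⟨M, hM, hpos, hmax⟩ := exists_isMaxOn_natRate hA hN₀ hd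
  have hlog2 : 0 < Real.log 2 := Real.log_pos one_lt_two
  have hrate {W : ℝ} (hW : 0 < W) := mul_logb_eq_natRate_div hA hN₀ hd hW
  refine ⟨M, hM, fun W hW => ?_, ?_, fun x hx y hy hxy => ?_⟩
  · rw [hrate hW, hrate hM]
    exact div_le_div_of_nonneg_right (hmax hW.le) hlog2.le
  · rw [hrate hM]
    exact div_pos hpos hlog2
  · have hx0 : 0 < x := hM.trans_le hx
    have hy0 : 0 < y := hM.trans_le hy
    beta_reduce
    rw [hrate hx0, hrate hy0]
    exact div_le_div_of_nonneg_right
      ((concaveOn_natRate hA hN₀ hd).antitoneOn_of_isMaxOn hM.le hmax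
        ⟨hx0.le, hx⟩ ⟨hy0.le, hy⟩ hxy) hlog2.le
end
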